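/- With Θ the context-free grammar constructed from a confluent context-free monadic rewriting system (A,R): for all u, w ∈ A*, if $_u ⇒*_Θ $_w then w ⇒*_R u. -/

import Mathlib

/-! Common framework: string rewriting systems and the grammar Θ constructed from a
confluent context-free monadic rewriting system `(A, R)`. -/

/-- Words over the alphabet `A`. -/
abbrev Word (A : Type) : Type := List A

/-- The word (of length at most one) corresponding to an element of `A ∪ {ε}`. -/
def toWord {A : Type} (a : Option A) : Word A := a.elim [] (fun b => [b])

/-- One rewriting step of the string rewriting system `R`. -/
def RWStep {A : Type} (R : Set (Word A × Word A)) (u v : Word A) : Prop :=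
  ∃ (x y l r : Word A), (l, r) ∈ R ∧ u = x ++ l ++ y ∧ v = x ++ r ++ y

/-- The reduction relation `⇒*_R`. -/
abbrev RWDerives {A : Type} (R : Set (Word A × Word A)) : Word A → Word A → Prop :=
  Relation.ReflTransGen (RWStep R)

/-- Equality in the monoid presented by `⟨A | R⟩`. -/
abbrev MonEq {A : Type} (R : Set (Word A × Word A)) : Word A → Word A → Prop :=
  Relation.EqvGen (RWStep R)

/-- Confluence of the rewriting system. -/
def RWConfluent {A : Type} (R : Set (Word A × Word A)) : Prop :=
  ∀ u u' u'' : Word A, RWDerives R u u' → RWDerives R u u'' →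
    ∃ v : Word A, RWDerives R u' v ∧ RWDerives R u'' v

/-- Monadic: length-reducing with right-hand sides in `A ∪ {ε}`. -/
def RWMonadic {A : Type} (R : Set (Word A × Word A)) : Prop :=
  ∀ p ∈ R, p.2.length < p.1.length ∧ p.2.length ≤ 1

/-- Terminal alphabet of the auxiliary grammar `Δ`:
the symbols `$_a`, `$̃_a` (for `a ∈ A ∪ {ε}`) together with `#₂`. -/
inductive DollarT (A : Type) : Type
  | dol : Option A → DollarT A
  | tdol : Option A → DollarT A
  | hash : DollarT A

/-- `$_p` as a word over `DollarT A`: `$_{p₁}⋯$_{p_n}` for `p ≠ ε`,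
and the single letter `$_ε` for `p = ε`. -/
def dW {A : Type} : Word A → List (DollarT A)
  | [] => [DollarT.dol none]
  | p => p.map (fun b => DollarT.dol (some b))

/-- `$̃_p` as a word over `DollarT A`. -/
def tdW {A : Type} : Word A → List (DollarT A)
  | [] => [DollarT.tdol none]
  | p => p.map (fun b => DollarT.tdol (some b))

/-- Nonterminals of `Θ`: the nonterminals of `Δ`, the symbols `$_a` and `$̃_a`
(`a ∈ A ∪ {ε}`), and the (pairwise disjoint) nonterminals of the grammars `Γ'_a`
and `Γ''_a`. -/
inductive ThetaNT (A : Type) (Γ : Option A → ContextFreeGrammar.{0} A)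
    (Δ : ContextFreeGrammar.{0} (DollarT A)) : Type
  | delta : Δ.NT → ThetaNT A Γ Δ
  | dol : Option A → ThetaNT A Γ Δ
  | tdol : Option A → ThetaNT A Γ Δ
  | prime : (a : Option A) → (Γ a).NT → ThetaNT A Γ Δ
  | dprime : (a : Option A) → (Γ a).NT → ThetaNT A Γ Δ

variable {A : Type} (Γ : Option A → ContextFreeGrammar.{0} A)
  (Δ : ContextFreeGrammar.{0} (DollarT A))

/-- Translation of symbols of `Γ_a` into symbols of `Θ`, realising `Γ'_a`:
each terminal `b` is replaced by the nonterminal `$_b`. -/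
def primeSym (a : Option A) : Symbol A (Γ a).NT → Symbol (Option A) (ThetaNT A Γ Δ)
  | Symbol.terminal b => Symbol.nonterminal (ThetaNT.dol (some b))
  | Symbol.nonterminal n => Symbol.nonterminal (ThetaNT.prime a n)

/-- Translation of symbols of `Γ_a` into symbols of `Θ`, realising `Γ''_a`:
each terminal `b` is replaced by the nonterminal `$̃_b`. -/
def dprimeSym (a : Option A) : Symbol A (Γ a).NT → Symbol (Option A) (ThetaNT A Γ Δ)
  | Symbol.terminal b => Symbol.nonterminal (ThetaNT.tdol (some b))
  | Symbol.nonterminal n => Symbol.nonterminal (ThetaNT.dprime a n)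

/-- Translation of symbols of `Δ` into symbols of `Θ`: the terminals `$_a`, `$̃_a`
of `Δ` become nonterminals of `Θ`, and `#₂` stays a terminal (encoded as `none`). -/
def deltaSym : Symbol (DollarT A) Δ.NT → Symbol (Option A) (ThetaNT A Γ Δ)
  | Symbol.terminal (DollarT.dol a) => Symbol.nonterminal (ThetaNT.dol a)
  | Symbol.terminal (DollarT.tdol a) => Symbol.nonterminal (ThetaNT.tdol a)
  | Symbol.terminal DollarT.hash => Symbol.terminal none
  | Symbol.nonterminal n => Symbol.nonterminal (ThetaNT.delta n)

/-- The productions of `Θ`: those of `Δ`, those of all `Γ'_a` and `Γ''_a`, the insertion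
productions `$_a → $_a $_ε`, `$_a → $_ε $_a`, `$̃_a → $̃_a $̃_ε`, `$̃_a → $̃_ε $̃_a`, the
start productions `$_a → O'_a`, `$̃_a → O''_a`, and the terminal productions
`$_a → a`, `$̃_a → a` (with `$_ε → ε`, `$̃_ε → ε`). -/
noncomputable def thetaRules [Fintype A] : List (ContextFreeRule (Option A) (ThetaNT A Γ Δ)) :=
  (Δ.rules.toList.map (fun r =>
    ⟨ThetaNT.delta r.input, r.output.map (deltaSym Γ Δ)⟩))
  ++ ((Finset.univ : Finset (Option A)).toList.flatMap (fun a =>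
      ((Γ a).rules.toList.map (fun r =>
        ⟨ThetaNT.prime a r.input, r.output.map (primeSym Γ Δ a)⟩))
      ++ ((Γ a).rules.toList.map (fun r =>
        ⟨ThetaNT.dprime a r.input, r.output.reverse.map (dprimeSym Γ Δ a)⟩))
      ++ [⟨ThetaNT.dol a, [Symbol.nonterminal (ThetaNT.dol a),
             Symbol.nonterminal (ThetaNT.dol none)]⟩,
          ⟨ThetaNT.dol a, [Symbol.nonterminal (ThetaNT.dol none),
             Symbol.nonterminal (ThetaNT.dol a)]⟩,
          ⟨ThetaNT.tdol a, [Symbol.nonterminal (ThetaNT.tdol a),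
             Symbol.nonterminal (ThetaNT.tdol none)]⟩,
          ⟨ThetaNT.tdol a, [Symbol.nonterminal (ThetaNT.tdol none),
             Symbol.nonterminal (ThetaNT.tdol a)]⟩,
          ⟨ThetaNT.dol a, [Symbol.nonterminal (ThetaNT.prime a (Γ a).initial)]⟩,
          ⟨ThetaNT.tdol a, [Symbol.nonterminal (ThetaNT.dprime a (Γ a).initial)]⟩,
          ⟨ThetaNT.dol a, (toWord a).map (fun b => Symbol.terminal (some b))⟩,
          ⟨ThetaNT.tdol a, (toWord a).map (fun b => Symbol.terminal (some b))⟩]))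

/-- The grammar `Θ`, over the terminal alphabet `A ∪ {#₂}` (encoded as `Option A`
with `none = #₂`), with start symbol `O_Δ`. -/
noncomputable def Theta [Fintype A] : ContextFreeGrammar.{0} (Option A) :=
  { NT := ThetaNT A Γ Δ
    initial := ThetaNT.delta Δ.initial
    rules := @List.toFinset _ (Classical.decEq _) (thetaRules Γ Δ) }

/-- `$_p` as a string of symbols of `Θ` (the single letter `$_ε` when `p = ε`). -/
def dols : Word A → List (Symbol (Option A) (ThetaNT A Γ Δ))
  | [] => [Symbol.nonterminal (ThetaNT.dol none)]
  | p => p.map (fun b => Symbol.nonterminal (ThetaNT.dol (some b)))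

/-- `$̃_p` as a string of symbols of `Θ` (the single letter `$̃_ε` when `p = ε`). -/
def tdols : Word A → List (Symbol (Option A) (ThetaNT A Γ Δ))
  | [] => [Symbol.nonterminal (ThetaNT.tdol none)]
  | p => p.map (fun b => Symbol.nonterminal (ThetaNT.tdol (some b)))

/-- A word over `A` as a string of terminal symbols of `Θ`. -/
def terms : Word A → List (Symbol (Option A) (ThetaNT A Γ Δ)) :=
  fun u => u.map (fun b => Symbol.terminal (some b))

section Semantics

theorem RWStep.append_context {R : Set (Word A × Word A)} {u v : Word A} (p q : Word A)
    (h : RWStep R u v) : RWStep R (p ++ u ++ q) (p ++ v ++ q) := by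
  obtain ⟨x, y, l, r, hlr, rfl, rfl⟩ := h
  exact ⟨p ++ x, y ++ q, l, r, hlr, by simp, by simp⟩

theorem RWDerives.append {R : Set (Word A × Word A)} {u u' v v' : Word A}
    (hu : RWDerives R u u') (hv : RWDerives R v v') : RWDerives R (u ++ v) (u' ++ v') := by
  have h₁ : RWDerives R (u ++ v) (u' ++ v) :=
    hu.lift (· ++ v) fun _ _ h => by simpa using h.append_context [] v
  have h₂ : RWDerives R (u' ++ v) (u' ++ v') :=
    hv.lift (u' ++ ·) fun _ _ h => by simpa using h.append_context u' []
  exact h₁.trans h₂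

/-- The words over `A` that reduce to a word represented by the given symbol of `Θ`; the symbols
that do not occur in words derived from `$_u` are unconstrained. -/
def symLang (R : Set (Word A × Word A)) : Symbol (Option A) (ThetaNT A Γ Δ) → Language A
  | Symbol.terminal (some b) => {v | RWDerives R v [b]}
  | Symbol.nonterminal (ThetaNT.dol a) => {v | RWDerives R v (toWord a)}
  | Symbol.nonterminal (ThetaNT.prime a n) =>
      {v | ∃ l : Word A, (Γ a).Derives [Symbol.nonterminal n] (l.map Symbol.terminal) ∧
        RWDerives R v l}
  | _ => {_v | True}

/-- The product of the languages `symLang` of the symbols of a string. -/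
def stringLang (R : Set (Word A × Word A)) (s : List (Symbol (Option A) (ThetaNT A Γ Δ))) :
    Language A :=
  (s.map (symLang Γ Δ R)).prod

variable {Γ Δ}

theorem stringLang_append (R : Set (Word A × Word A))
    (s t : List (Symbol (Option A) (ThetaNT A Γ Δ))) :
    stringLang Γ Δ R (s ++ t) = stringLang Γ Δ R s * stringLang Γ Δ R t := by
  simp [stringLang]

theorem stringLang_singleton (R : Set (Word A × Word A))
    (x : Symbol (Option A) (ThetaNT A Γ Δ)) :
    stringLang Γ Δ R [x] = symLang Γ Δ R x := by
  simp [stringLang]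

theorem stringLang_cons (R : Set (Word A × Word A)) (x : Symbol (Option A) (ThetaNT A Γ Δ))
    (s : List (Symbol (Option A) (ThetaNT A Γ Δ))) :
    stringLang Γ Δ R (x :: s) = symLang Γ Δ R x * stringLang Γ Δ R s := by
  simp [stringLang]

theorem mem_stringLang_nil {R : Set (Word A × Word A)} {v : Word A} :
    v ∈ stringLang Γ Δ R [] ↔ v = [] :=
  Iff.rfl

theorem exists_derives_of_mem_stringLang_primeSym {R : Set (Word A × Word A)} (a : Option A)
    (s : List (Symbol A (Γ a).NT)) (v : Word A)
    (hv : v ∈ stringLang Γ Δ R (s.map (primeSym Γ Δ a))) :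
    ∃ l : Word A, (Γ a).Derives s (l.map Symbol.terminal) ∧ RWDerives R v l := by
  induction s generalizing v with
  | nil =>
    obtain rfl := mem_stringLang_nil.mp hv
    exact ⟨[], ContextFreeGrammar.Derives.refl _, Relation.ReflTransGen.refl⟩
  | cons x s ih =>
    rw [List.map_cons, stringLang_cons, Language.mem_mul] at hv
    obtain ⟨v₁, h₁, v₂, h₂, rfl⟩ := hv
    obtain ⟨l₂, d₂, r₂⟩ := ih v₂ h₂
    have hx : ∃ l₁ : Word A, (Γ a).Derives [x] (l₁.map Symbol.terminal) ∧ RWDerives R v₁ l₁ := by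
      cases x with
      | terminal b => exact ⟨[b], ContextFreeGrammar.Derives.refl _, h₁⟩
      | nonterminal n => exact h₁
    obtain ⟨l₁, d₁, r₁⟩ := hx
    refine ⟨l₁ ++ l₂, ?_, r₁.append r₂⟩
    rw [List.map_append]
    exact (d₁.append_right s).trans (d₂.append_left _)

theorem stringLang_output_le_symLang_input [Fintype A] {R : Set (Word A × Word A)}
    (hΓ : ∀ a : Option A, ∀ l ∈ (Γ a).language, (l, toWord a) ∈ R)
    {r : ContextFreeRule (Option A) (ThetaNT A Γ Δ)} (hr : r ∈ thetaRules Γ Δ) :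
    stringLang Γ Δ R r.output ≤ symLang Γ Δ R (Symbol.nonterminal r.input) := by
  intro v hv
  simp only [thetaRules, List.mem_append, List.mem_map, List.mem_flatMap, List.mem_cons,
    List.not_mem_nil, or_false] at hr
  rcases hr with ⟨q, -, rfl⟩ | ⟨a, -, (⟨q, hq, rfl⟩ | ⟨q, -, rfl⟩) |
    rfl | rfl | rfl | rfl | rfl | rfl | rfl | rfl⟩
  · trivial
  · obtain ⟨l, hl, hvl⟩ := exists_derives_of_mem_stringLang_primeSym a q.output v hv
    have hstep : (Γ a).Produces [Symbol.nonterminal q.input] q.output :=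
      ⟨q, Finset.mem_toList.mp hq, ContextFreeRule.Rewrites.input_output⟩
    exact ⟨l, hstep.trans_derives hl, hvl⟩
  · trivial
  · change v ∈ stringLang Γ Δ R [_, _] at hv
    rw [stringLang_cons, stringLang_singleton, Language.mem_mul] at hv
    obtain ⟨v₁, h₁, v₂, h₂, rfl⟩ := hv
    have h : RWDerives R (v₁ ++ v₂) (toWord a ++ []) := RWDerives.append h₁ h₂
    rw [List.append_nil] at h
    exact h
  · change v ∈ stringLang Γ Δ R [_, _] at hv
    rw [stringLang_cons, stringLang_singleton, Language.mem_mul] at hv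
    obtain ⟨v₁, h₁, v₂, h₂, rfl⟩ := hv
    exact RWDerives.append h₁ h₂
  · trivial
  · trivial
  · change v ∈ stringLang Γ Δ R [_] at hv
    rw [stringLang_singleton] at hv
    obtain ⟨l, hl, hvl⟩ := hv
    exact hvl.tail ⟨[], [], l, toWord a, hΓ a l hl, by simp, by simp⟩
  · trivial
  · cases a with
    | none =>
      obtain rfl : v = [] := mem_stringLang_nil.mp hv
      exact Relation.ReflTransGen.refl
    | some b =>
      change v ∈ stringLang Γ Δ R [_] at hv
      rw [stringLang_singleton] at hv
      exact hv
  · trivial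

theorem stringLang_le_of_rewrites [Fintype A] {R : Set (Word A × Word A)}
    (hΓ : ∀ a : Option A, ∀ l ∈ (Γ a).language, (l, toWord a) ∈ R)
    {r : ContextFreeRule (Option A) (ThetaNT A Γ Δ)} (hr : r ∈ thetaRules Γ Δ)
    {s t : List (Symbol (Option A) (ThetaNT A Γ Δ))} (h : r.Rewrites s t) :
    stringLang Γ Δ R t ≤ stringLang Γ Δ R s := by
  obtain ⟨p, q, rfl, rfl⟩ := h.exists_parts
  simp only [stringLang_append, stringLang_singleton]
  gcongr
  exact stringLang_output_le_symLang_input hΓ hr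

theorem stringLang_le_of_derives [Fintype A] {R : Set (Word A × Word A)}
    (hΓ : ∀ a : Option A, ∀ l ∈ (Γ a).language, (l, toWord a) ∈ R)
    {s t : List (Symbol (Option A) (ThetaNT A Γ Δ))} (h : (Theta Γ Δ).Derives s t) :
    stringLang Γ Δ R t ≤ stringLang Γ Δ R s := by
  induction h with
  | refl => exact le_rfl
  | tail _ hstep ih =>
    obtain ⟨r, hr, hrw⟩ := hstep
    exact (stringLang_le_of_rewrites hΓ ((@List.mem_toFinset _ (Classical.decEq _) _ _).mp hr)
      hrw).trans ih

theorem mem_stringLang_map_dol {R : Set (Word A × Word A)} {w v : Word A} :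
    v ∈ stringLang Γ Δ R (w.map fun b => Symbol.nonterminal (ThetaNT.dol (some b))) →
      RWDerives R v w := by
  induction w generalizing v with
  | nil =>
    intro hv
    obtain rfl : v = [] := mem_stringLang_nil.mp hv
    exact Relation.ReflTransGen.refl
  | cons b w ih =>
    rw [List.map_cons, stringLang_cons, Language.mem_mul]
    rintro ⟨v₁, h₁, v₂, h₂, rfl⟩
    have h : RWDerives R v₁ [b] := h₁
    exact h.append (ih h₂)

theorem self_mem_stringLang_map_dol {R : Set (Word A × Word A)} (w : Word A) :
    w ∈ stringLang Γ Δ R (w.map fun b => Symbol.nonterminal (ThetaNT.dol (some b))) := by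
  induction w with
  | nil => exact mem_stringLang_nil.mpr rfl
  | cons b w ih =>
    rw [List.map_cons, stringLang_cons, Language.mem_mul]
    have h : RWDerives R [b] [b] := Relation.ReflTransGen.refl
    exact ⟨[b], h, w, ih, rfl⟩

theorem rwDerives_of_mem_stringLang_dols {R : Set (Word A × Word A)} {w v : Word A}
    (hv : v ∈ stringLang Γ Δ R (dols Γ Δ w)) : RWDerives R v w := by
  cases w with
  | nil =>
    rw [dols, stringLang_singleton] at hv
    exact hv
  | cons b w => exact mem_stringLang_map_dol hv

theorem self_mem_stringLang_dols {R : Set (Word A × Word A)} (w : Word A) :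
    w ∈ stringLang Γ Δ R (dols Γ Δ w) := by
  cases w with
  | nil =>
    rw [dols, stringLang_singleton]
    exact (Relation.ReflTransGen.refl : RWDerives R [] [])
  | cons b w => exact self_mem_stringLang_map_dol (b :: w)

end Semantics

/-- **Lemma 3.4.** For all `u, w ∈ A*`, if `$_u ⇒*_Θ $_w` then `w ⇒*_R u`. -/
theorem rwDerives_of_derives_dols
    {A : Type} [Fintype A] (R : Set (Word A × Word A))
    (hconf : RWConfluent R) (hmon : RWMonadic R)
    (Γ : Option A → ContextFreeGrammar.{0} A)
    (hΓ : ∀ a : Option A, (Γ a).language = {l : Word A | (l, toWord a) ∈ R})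
    (hΓeps : ∀ a : Option A, ∀ r ∈ (Γ a).rules, r.output ≠ [])
    (Δ : ContextFreeGrammar.{0} (DollarT A))
    (hΔ : Δ.language =
      {x | ∃ p : Word A, x = dW p ++ [DollarT.hash] ++ tdW p.reverse}) :
    ∀ u w : Word A,
      (Theta Γ Δ).Derives (dols Γ Δ u) (dols Γ Δ w) → RWDerives R w u := by
  intro u w h
  have hR : ∀ a : Option A, ∀ l ∈ (Γ a).language, (l, toWord a) ∈ R := fun a l hl => by
    rw [hΓ a] at hl
    exact hl
  exact rwDerives_of_mem_stringLang_dols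
    (stringLang_le_of_derives hR h (self_mem_stringLang_dols w))
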